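/- If G is a finite simple graph with mad(G) < 25/4, then τ(G) ≤ 2ν(G). -/

import Mathlib

open SimpleGraph

variable {V : Type*}

/-- `S` is a set of pairwise edge-disjoint triangles of `G` (two triangles, viewed as
3-element vertex sets, are edge-disjoint iff they share at most one vertex). -/
def EdgeDisjointTriangles [DecidableEq V] (G : SimpleGraph V) (S : Finset (Finset V)) : Prop :=
  (∀ t ∈ S, G.IsNClique 3 t) ∧
    ∀ t₁ ∈ S, ∀ t₂ ∈ S, t₁ ≠ t₂ → (t₁ ∩ t₂).card ≤ 1

/-- ν(G): the maximum size of a set of pairwise edge-disjoint triangles of `G`. -/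
noncomputable def triNu [DecidableEq V] (G : SimpleGraph V) : ℕ :=
  sSup {n | ∃ S : Finset (Finset V), EdgeDisjointTriangles G S ∧ S.card = n}

/-- τ(G): the minimum size of an edge set `Y` such that `G - Y` is triangle-free. -/
noncomputable def triTau [DecidableEq V] (G : SimpleGraph V) : ℕ :=
  sInf {n | ∃ Y : Finset (Sym2 V), ↑Y ⊆ G.edgeSet ∧
    (G.deleteEdges ↑Y).CliqueFree 3 ∧ Y.card = n}


/-- A convenient form of the inequality `τ ≤ 2 ν`. -/
def GoodG [DecidableEq V] (G : SimpleGraph V) : Prop :=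
  ∃ (S : Finset (Finset V)) (Y : Finset (Sym2 V)), EdgeDisjointTriangles G S ∧
    (∀ a b c, G.Adj a b → G.Adj a c → G.Adj b c → s(a,b) ∈ Y ∨ s(a,c) ∈ Y ∨ s(b,c) ∈ Y) ∧
    Y.card ≤ 2 * S.card

lemma GoodG.le [Fintype V] [DecidableEq V] {G : SimpleGraph V} (h : GoodG G) :
    triTau G ≤ 2 * triNu G := by
  classical
  obtain ⟨S, Y, hS, hY, hc⟩ := h
  have h1 : triTau G ≤ (Y.filter (· ∈ G.edgeSet)).card := by
    apply Nat.sInf_le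
    refine ⟨_, ?_, ?_, rfl⟩
    · intro e he
      simp at he
      exact he.2
    · intro t ht
      obtain ⟨a, b, c, hab, hac, hbc, rfl⟩ := SimpleGraph.is3Clique_iff.1 ht
      simp only [SimpleGraph.deleteEdges_adj, Finset.coe_filter, Set.mem_ofPred_eq,
        SimpleGraph.mem_edgeSet, not_and] at hab hac hbc
      have := hY a b c hab.1 hac.1 hbc.1
      tauto
  have h2 : S.card ≤ triNu G := by
    apply le_csSup
    · refine ⟨Fintype.card (Finset V), ?_⟩
      rintro n ⟨T, -, rfl⟩
      exact Finset.card_le_univ T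
    · exact ⟨S, hS, rfl⟩
  have h3 := Finset.card_filter_le Y (· ∈ G.edgeSet)
  omega

/-- Minimal counterexample. -/
def CritG [DecidableEq V] (G : SimpleGraph V) : Prop :=
  ¬ GoodG G ∧ ∀ H < G, GoodG H

lemma CritG.triangle [DecidableEq V] {G : SimpleGraph V} (hG : CritG G) {u v : V}
    (huv : G.Adj u v) : ∃ w, G.Adj u w ∧ G.Adj v w := by
  by_contra hno
  push Not at hno
  obtain ⟨S, Y, hS, hY, hc⟩ := hG.2 (G.deleteEdges {s(u,v)}) (by
    refine lt_of_le_of_ne (SimpleGraph.deleteEdges_le _) ?_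
    intro h
    rw [← h] at huv
    simp at huv)
  refine hG.1 ⟨S, Y, ⟨fun t ht => (hS.1 t ht).mono (SimpleGraph.deleteEdges_le _), hS.2⟩, ?_, hc⟩
  have key : ∀ a b c, G.Adj a b → G.Adj a c → G.Adj b c → s(a,b) ≠ s(u,v) := by
    intro a b c hab hac hbc h
    rw [Sym2.eq_iff] at h
    rcases h with ⟨rfl, rfl⟩ | ⟨rfl, rfl⟩
    · exact hno c hac hbc
    · exact hno c hbc hac
  intro a b c hab hac hbc
  apply hY a b c <;> simp only [SimpleGraph.deleteEdges_adj, Set.mem_singleton_iff]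
  · exact ⟨hab, key a b c hab hac hbc⟩
  · exact ⟨hac, key a c b hac hab hbc.symm⟩
  · exact ⟨hbc, key b c a hbc hab.symm hac.symm⟩

lemma CritG.reduce [DecidableEq V] {G : SimpleGraph V} (hG : CritG G) (V0 : Finset V)
    (S : Finset (Finset V)) (X : Finset (Sym2 V))
    (hne : ∃ v ∈ V0, ∃ w, G.Adj v w) (hS : EdgeDisjointTriangles G S)
    (hout : ∀ t ∈ S, ∀ a ∈ t, ∀ b ∈ t, a ≠ b → a ∉ V0 → b ∉ V0 → s(a,b) ∈ X)
    (hcov : ∀ a ∈ V0, ∀ b c, G.Adj a b → G.Adj a c → G.Adj b c →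
      s(a,b) ∈ X ∨ s(a,c) ∈ X ∨ s(b,c) ∈ X)
    (hcard : X.card ≤ 2 * S.card) : False := by
  let H : SimpleGraph V :=
    { Adj := fun a b => G.Adj a b ∧ a ∉ V0 ∧ b ∉ V0 ∧ s(a,b) ∉ X
      symm := ⟨fun a b h => ⟨h.1.symm, h.2.2.1, h.2.1, by rw [Sym2.eq_swap]; exact h.2.2.2⟩⟩
      loopless := ⟨fun a h => G.loopless.irrefl a h.1⟩ }
  have hle : H ≤ G := fun a b h => h.1
  have hlt : H < G := by
    refine lt_of_le_of_ne hle ?_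
    intro h
    obtain ⟨v, hv, w, hvw⟩ := hne
    rw [← h] at hvw
    exact hvw.2.1 hv
  obtain ⟨S', Y', hS', hY', hc'⟩ := hG.2 H hlt
  have hcross : ∀ t ∈ S, ∀ t' ∈ S', (t ∩ t').card ≤ 1 := by
    intro t ht t' ht'
    by_contra hcon
    push Not at hcon
    obtain ⟨a, ha, b, hb, hab⟩ := Finset.one_lt_card.1 hcon
    rw [Finset.mem_inter] at ha hb
    have := (hS'.1 t' ht').1 ha.2 hb.2 hab
    exact this.2.2.2 (hout t ht a ha.1 b hb.1 hab this.2.1 this.2.2.1)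
  have hdisj : Disjoint S S' := by
    rw [Finset.disjoint_left]
    intro t ht ht'
    have h1 := hcross t ht t ht'
    rw [Finset.inter_self, (hS.1 t ht).2] at h1
    omega
  refine hG.1 ⟨S ∪ S', X ∪ Y', ⟨?_, ?_⟩, ?_, ?_⟩
  · intro t ht
    rcases Finset.mem_union.1 ht with h | h
    · exact hS.1 t h
    · exact (hS'.1 t h).mono hle
  · intro t₁ h₁ t₂ h₂ hne
    rcases Finset.mem_union.1 h₁ with h₁ | h₁ <;> rcases Finset.mem_union.1 h₂ with h₂ | h₂
    · exact hS.2 _ h₁ _ h₂ hne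
    · exact hcross _ h₁ _ h₂
    · rw [Finset.inter_comm]; exact hcross _ h₂ _ h₁
    · exact hS'.2 _ h₁ _ h₂ hne
  · intro a b c hab hac hbc
    simp only [Finset.mem_union]
    by_cases ha : a ∈ V0
    · have := hcov a ha b c hab hac hbc
      tauto
    by_cases hb : b ∈ V0
    · have := hcov b hb a c hab.symm hbc hac
      rw [Sym2.eq_swap (a := b) (b := a)] at this
      tauto
    by_cases hc : c ∈ V0
    · have := hcov c hc a b hac.symm hbc.symm hab
      rw [Sym2.eq_swap (a := c) (b := a), Sym2.eq_swap (a := c) (b := b)] at this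
      tauto
    by_cases h1 : s(a,b) ∈ X
    · tauto
    by_cases h2 : s(a,c) ∈ X
    · tauto
    by_cases h3 : s(b,c) ∈ X
    · tauto
    have := hY' a b c ⟨hab, ha, hb, h1⟩ ⟨hac, ha, hc, h2⟩ ⟨hbc, hb, hc, h3⟩
    tauto
  · rw [Finset.card_union_of_disjoint hdisj]
    have := Finset.card_union_le X Y'
    omega

/-- vertex set of an index triple -/
def triSet {n : ℕ} (t : Fin n × Fin n × Fin n) : Finset (Fin n) := {t.1, t.2.1, t.2.2}

/-- index pair membership, up to orientation -/
def pmem {n : ℕ} (L : List (Fin n × Fin n)) (i j : Fin n) : Prop := (i,j) ∈ L ∨ (j,i) ∈ L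

instance {n : ℕ} (L : List (Fin n × Fin n)) (i j : Fin n) : Decidable (pmem L i j) := by
  unfold pmem; infer_instance

/-- The finite combinatorial check for a reducible configuration. -/
def RCheck (n : ℕ) (V0 : List (Fin n)) (S : List (Fin n × Fin n × Fin n))
    (X N : List (Fin n × Fin n)) : Prop :=
  V0 ≠ [] ∧ S.Pairwise (fun s t => (triSet s ∩ triSet t).card ≤ 1) ∧
  (∀ t ∈ S, ∀ i ∈ triSet t, ∀ j ∈ triSet t, i ≠ j → i ∉ V0 → j ∉ V0 → pmem X i j) ∧
  (∀ i ∈ V0, ∀ j k, i ≠ j → i ≠ k → j < k → pmem X i j ∨ pmem X i k ∨ pmem X j k ∨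
    pmem N i j ∨ pmem N i k ∨ pmem N j k) ∧ X.length ≤ 2 * S.length

set_option synthInstance.maxHeartbeats 400000 in
set_option synthInstance.maxSize 2000 in
instance (n : ℕ) (V0 : List (Fin n)) (S : List (Fin n × Fin n × Fin n))
    (X N : List (Fin n × Fin n)) : Decidable (RCheck n V0 S X N) := by
  unfold RCheck; infer_instance

lemma CritG.reduceFin [DecidableEq V] {G : SimpleGraph V} (hG : CritG G) {n : ℕ}
    {f : Fin n → V} (hf : Function.Injective f) (V0 : List (Fin n))
    (S : List (Fin n × Fin n × Fin n)) (X N : List (Fin n × Fin n))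
    (hV0 : ∀ i ∈ V0, ∀ w, G.Adj (f i) w → ∃ j, f j = w)
    (hV1 : ∀ i ∈ V0, ∃ w, G.Adj (f i) w)
    (hS : ∀ t ∈ S, G.Adj (f t.1) (f t.2.1) ∧ G.Adj (f t.1) (f t.2.2) ∧ G.Adj (f t.2.1) (f t.2.2))
    (hN : ∀ p ∈ N, ¬ G.Adj (f p.1) (f p.2))
    (hc : RCheck n V0 S X N) : False := by
  obtain ⟨c0, c1, c2, c3, c4⟩ := hc
  let F : Fin n ↪ V := ⟨f, hf⟩
  let T : Fin n × Fin n × Fin n → Finset V := fun t => (triSet t).map F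
  let e : Fin n × Fin n → Sym2 V := fun p => s(f p.1, f p.2)
  have hcl : ∀ t ∈ S, G.IsNClique 3 (T t) := by
    intro t ht
    rw [SimpleGraph.is3Clique_iff]
    refine ⟨f t.1, f t.2.1, f t.2.2, (hS t ht).1, (hS t ht).2.1, (hS t ht).2.2, ?_⟩
    simp [T, triSet, F]
  have hpm : ∀ i j, pmem X i j → s(f i, f j) ∈ (X.map e).toFinset := by
    intro i j h
    rw [List.mem_toFinset, List.mem_map]
    rcases h with h | h
    · exact ⟨_, h, rfl⟩
    · exact ⟨_, h, Sym2.eq_swap⟩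
  have hpn : ∀ i j, pmem N i j → ¬ G.Adj (f i) (f j) := by
    intro i j h
    rcases h with h | h
    · exact hN _ h
    · exact fun h' => hN _ h h'.symm
  have hpw : (S.map T).Pairwise (fun s t => (s ∩ t).card ≤ 1) := by
    rw [List.pairwise_map]
    refine c1.imp ?_
    intro s t h
    simp only [T]
    rw [← Finset.map_inter, Finset.card_map]
    exact h
  have hnd : (S.map T).Nodup := by
    refine List.Pairwise.imp_of_mem ?_ hpw
    intro s t hs _ h hst
    subst hst
    obtain ⟨t, ht, rfl⟩ := List.mem_map.1 hs
    rw [Finset.inter_self, (hcl t ht).2] at h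
    omega
  refine hG.reduce (V0.map f).toFinset (S.map T).toFinset (X.map e).toFinset ?_ ⟨?_, ?_⟩ ?_ ?_ ?_
  · obtain ⟨i, hi⟩ := List.exists_mem_of_ne_nil _ c0
    obtain ⟨w, hw⟩ := hV1 i hi
    exact ⟨f i, by simpa using ⟨i, hi, rfl⟩, w, hw⟩
  · intro t ht
    rw [List.mem_toFinset, List.mem_map] at ht
    obtain ⟨t, ht, rfl⟩ := ht
    exact hcl t ht
  · intro t₁ h₁ t₂ h₂ hne
    rw [List.mem_toFinset] at h₁ h₂
    have : Std.Symm (fun s t : Finset V => (s ∩ t).card ≤ 1) :=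
      ⟨fun a b h => by rw [Finset.inter_comm]; exact h⟩
    exact hpw.forall h₁ h₂ hne
  · intro t ht a ha b hb hab ha0 hb0
    rw [List.mem_toFinset, List.mem_map] at ht
    obtain ⟨t, ht, rfl⟩ := ht
    obtain ⟨i, hi, rfl⟩ := Finset.mem_map.1 ha
    obtain ⟨j, hj, rfl⟩ := Finset.mem_map.1 hb
    refine hpm _ _ (c2 t ht i hi j hj (fun h => hab (by rw [h])) ?_ ?_)
    · intro h
      exact ha0 (by rw [List.mem_toFinset]; exact List.mem_map_of_mem h)
    · intro h
      exact hb0 (by rw [List.mem_toFinset]; exact List.mem_map_of_mem h)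
  · intro a ha b c hab hac hbc
    rw [List.mem_toFinset, List.mem_map] at ha
    obtain ⟨i, hi, rfl⟩ := ha
    obtain ⟨j, rfl⟩ := hV0 i hi b hab
    obtain ⟨k, rfl⟩ := hV0 i hi c hac
    have hij : i ≠ j := fun h => hab.ne (by rw [h])
    have hik : i ≠ k := fun h => hac.ne (by rw [h])
    have hjk : j ≠ k := fun h => hbc.ne (by rw [h])
    rcases lt_or_gt_of_ne hjk with h | h
    · rcases c3 i hi j k hij hik h with h | h | h | h | h | h
      · exact Or.inl (hpm _ _ h)
      · exact Or.inr (Or.inl (hpm _ _ h))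
      · exact Or.inr (Or.inr (hpm _ _ h))
      · exact absurd hab (hpn _ _ h)
      · exact absurd hac (hpn _ _ h)
      · exact absurd hbc (hpn _ _ h)
    · rcases c3 i hi k j hik hij h with h | h | h | h | h | h
      · exact Or.inr (Or.inl (hpm _ _ h))
      · exact Or.inl (hpm _ _ h)
      · exact Or.inr (Or.inr (by rw [Sym2.eq_swap]; exact hpm _ _ h))
      · exact absurd hac (hpn _ _ h)
      · exact absurd hab (hpn _ _ h)
      · exact absurd hbc.symm (hpn _ _ h)
  · rw [List.toFinset_card_of_nodup hnd, List.length_map]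
    refine le_trans (List.toFinset_card_le _) ?_
    rw [List.length_map]
    exact c4

/-- `f 0` is a vertex whose neighbours are exactly `f 1, …, f n`, without repetition. -/
structure StarF (G : SimpleGraph V) {n : ℕ} (f : Fin (n + 1) → V) : Prop where
  inj : Function.Injective f
  range : ∀ w, G.Adj (f 0) w ↔ ∃ j, j ≠ 0 ∧ f j = w
  pos : 0 < n

lemma CritG.wke [DecidableEq V] {G : SimpleGraph V} (hG : CritG G) {n : ℕ}
    {f : Fin (n + 1) → V} (hs : StarF G f) (M : List (Fin (n + 1) × Fin (n + 1)))
    (Q : List (Fin (n + 1))) (N : List (Fin (n + 1) × Fin (n + 1)))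
    (hM : ∀ p ∈ M, G.Adj (f p.1) (f p.2)) (hN : ∀ p ∈ N, ¬ G.Adj (f p.1) (f p.2))
    (hc : RCheck (n + 1) [0] (M.map (fun p => (0, p))) (M ++ Q.map (fun q => (0, q))) N ∧
      ∀ p ∈ M, p.1 ≠ 0 ∧ p.2 ≠ 0) : False := by
  refine hG.reduceFin hs.inj _ _ _ N ?_ ?_ ?_ hN hc.1
  · intro i hi w hw
    rw [List.mem_singleton] at hi
    subst hi
    obtain ⟨j, -, h⟩ := (hs.range w).1 hw
    exact ⟨j, h⟩
  · intro i hi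
    rw [List.mem_singleton] at hi
    subst hi
    refine ⟨f (Fin.last n), (hs.range _).2 ⟨_, ?_, rfl⟩⟩
    have := hs.pos
    intro h
    rw [Fin.ext_iff] at h
    simp at h
    omega
  · intro t ht
    obtain ⟨p, hp, rfl⟩ := List.mem_map.1 ht
    exact ⟨(hs.range _).2 ⟨_, (hc.2 p hp).1, rfl⟩, (hs.range _).2 ⟨_, (hc.2 p hp).2, rfl⟩, hM p hp⟩

lemma CritG.iso [DecidableEq V] {G : SimpleGraph V} (hG : CritG G) {n : ℕ}
    {f : Fin (n + 1) → V} (hs : StarF G f) (i : Fin (n + 1)) (N : List (Fin (n + 1) × Fin (n + 1)))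
    (hN : ∀ p ∈ N, ¬ G.Adj (f p.1) (f p.2))
    (hc : i ≠ 0 ∧ ∀ j, j ≠ 0 → j ≠ i → pmem N i j) : False := by
  obtain ⟨w, hw, hw'⟩ := hG.triangle ((hs.range (f i)).2 ⟨i, hc.1, rfl⟩)
  obtain ⟨j, hj, rfl⟩ := (hs.range w).1 hw
  rcases hc.2 j hj (fun h => hw'.ne (by rw [h])) with h | h
  · exact hN _ h hw'
  · exact hN _ h hw'.symm

lemma StarF.mk' [Fintype V] [DecidableEq V] {G : SimpleGraph V} [DecidableRel G.Adj] {v : V} {n : ℕ}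
    (g : Fin n → V) (hd : G.degree v = n) (hn : 0 < n) (hr : ∀ w, G.Adj v w ↔ ∃ j, g j = w) :
    StarF G (Matrix.vecCons v g) := by
  have himg : Finset.univ.image g = G.neighborFinset v := by
    ext w
    simp [hr]
  have hinj : Function.Injective g := by
    have h1 : (Finset.univ.image g).card = (Finset.univ : Finset (Fin n)).card := by
      rw [himg, Finset.card_univ, Fintype.card_fin]
      exact hd
    have h2 := Finset.card_image_iff.1 h1
    rwa [Finset.coe_univ, Set.injOn_univ] at h2
  refine ⟨?_, ?_, hn⟩
  · unfold Matrix.vecCons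
    rw [Fin.cons_injective_iff]
    refine ⟨?_, hinj⟩
    rintro ⟨j, hj⟩
    exact G.loopless.irrefl v ((hr v).2 ⟨j, hj⟩)
  · intro w
    simp only [Matrix.cons_val_zero, hr]
    constructor
    · rintro ⟨j, rfl⟩
      exact ⟨j.succ, Fin.succ_ne_zero j, by simp⟩
    · rintro ⟨j, hj, rfl⟩
      obtain ⟨k, rfl⟩ := Fin.exists_succ_eq.2 hj
      exact ⟨k, by simp⟩

lemma CritG.star3 [DecidableEq V] {G : SimpleGraph V} (hG : CritG G) {f : Fin 4 → V}
    (hs : StarF G f) (h12 : G.Adj (f 1) (f 2)) : False := by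
  exact hG.wke hs [(1,2)] [3] [] (by simp [*]) (by simp) (by decide +kernel)

lemma CritG.star2 [DecidableEq V] {G : SimpleGraph V} (hG : CritG G) {f : Fin 3 → V}
    (hs : StarF G f) (h12 : G.Adj (f 1) (f 2)) : False := by
  exact hG.wke hs [(1,2)] [] [] (by simp [*]) (by simp) (by decide +kernel)

lemma CritG.star4 [DecidableEq V] {G : SimpleGraph V} (hG : CritG G) {f : Fin 5 → V}
    (hs : StarF G f) (h12 : G.Adj (f 1) (f 2)) : False := by
  by_cases h34 : G.Adj (f 3) (f 4)
  · exact hG.wke hs [(1,2),(3,4)] [1,2]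
      []
      (by simp [*]) (by simp [*]) (by decide +kernel)
  · by_cases h13 : G.Adj (f 1) (f 3)
    · by_cases h24 : G.Adj (f 2) (f 4)
      · exact hG.wke hs [(1,3),(2,4)] [1,2]
          [(3,4)]
          (by simp [*]) (by simp [*]) (by decide +kernel)
      · by_cases h23 : G.Adj (f 2) (f 3)
        · exact hG.wke hs [(2,3)] [1]
            [(2,4),(3,4)]
            (by simp [*]) (by simp [*]) (by decide +kernel)
        · exact hG.wke hs [(1,2)] [1]
            [(2,3),(2,4),(3,4)]
            (by simp [*]) (by simp [*]) (by decide +kernel)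
    · by_cases h14 : G.Adj (f 1) (f 4)
      · exact hG.wke hs [(1,4)] [2]
          [(1,3),(3,4)]
          (by simp [*]) (by simp [*]) (by decide +kernel)
      · exact hG.wke hs [(1,2)] [2]
          [(1,3),(1,4),(3,4)]
          (by simp [*]) (by simp [*]) (by decide +kernel)

lemma CritG.star5 [DecidableEq V] {G : SimpleGraph V} (hG : CritG G) {f : Fin 6 → V}
    (hs : StarF G f) (h12 : ¬ G.Adj (f 1) (f 2)) (h13 : ¬ G.Adj (f 1) (f 3))
    (h14 : G.Adj (f 1) (f 4)) : False := by
  by_cases h23 : G.Adj (f 2) (f 3)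
  · exact hG.wke hs [(1,4),(2,3)] [4,5]
      [(1,2),(1,3)]
      (by simp [*]) (by simp [*]) (by decide +kernel)
  · by_cases h25 : G.Adj (f 2) (f 5)
    · exact hG.wke hs [(1,4),(2,5)] [4,5]
        [(1,2),(1,3),(2,3)]
        (by simp [*]) (by simp [*]) (by decide +kernel)
    · by_cases h35 : G.Adj (f 3) (f 5)
      · exact hG.wke hs [(1,4),(3,5)] [1,4]
          [(2,3),(2,5)]
          (by simp [*]) (by simp [*]) (by decide +kernel)
      · by_cases h15 : G.Adj (f 1) (f 5)
        · exact hG.wke hs [(1,5)] [4]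
            [(1,2),(1,3),(2,3),(2,5),(3,5)]
            (by simp [*]) (by simp [*]) (by decide +kernel)
        · exact hG.wke hs [(1,4)] [4]
            [(1,2),(1,3),(1,5),(2,3),(2,5),(3,5)]
            (by simp [*]) (by simp [*]) (by decide +kernel)

lemma CritG.star6 [DecidableEq V] {G : SimpleGraph V} (hG : CritG G) {f : Fin 7 → V}
    (hs : StarF G f) (h12 : ¬ G.Adj (f 1) (f 2)) (h13 : ¬ G.Adj (f 1) (f 3))
    (h14 : G.Adj (f 1) (f 4)) : False := by
  by_cases h23 : G.Adj (f 2) (f 3)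
  · by_cases h56 : G.Adj (f 5) (f 6)
    · exact hG.wke hs [(1,4),(2,3),(5,6)] [4,5,6]
        [(1,2),(1,3)]
        (by simp [*]) (by simp [*]) (by decide +kernel)
    · by_cases h25 : G.Adj (f 2) (f 5)
      · by_cases h36 : G.Adj (f 3) (f 6)
        · by_cases h15 : G.Adj (f 1) (f 5)
          · by_cases h46 : G.Adj (f 4) (f 6)
            · exact hG.wke hs [(1,5),(2,3),(4,6)] [4,5,6]
                [(1,2),(1,3)]
                (by simp [*]) (by simp [*]) (by decide +kernel)
            · by_cases h16 : G.Adj (f 1) (f 6)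
              · by_cases h45 : G.Adj (f 4) (f 5)
                · exact hG.wke hs [(1,6),(2,3),(4,5)] [1,2,3]
                    [(4,6),(5,6)]
                    (by simp [*]) (by simp [*]) (by decide +kernel)
                · exact hG.wke hs [(1,4),(2,5),(3,6)] [1,2,3]
                    [(4,5),(4,6),(5,6)]
                    (by simp [*]) (by simp [*]) (by decide +kernel)
              · exact hG.wke hs [(1,4),(2,5),(3,6)] [2,3,5]
                  [(1,6),(4,6)]
                  (by simp [*]) (by simp [*]) (by decide +kernel)
          · exact hG.wke hs [(1,4),(2,5),(3,6)] [3,4,6]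
              [(1,2),(1,5)]
              (by simp [*]) (by simp [*]) (by decide +kernel)
        · by_cases h35 : G.Adj (f 3) (f 5)
          · by_cases h26 : G.Adj (f 2) (f 6)
            · exact hG.wke hs [(1,4),(2,6),(3,5)] [1,2,4]
                [(3,6),(5,6)]
                (by simp [*]) (by simp [*]) (by decide +kernel)
            · by_cases h16 : G.Adj (f 1) (f 6)
              · exact hG.wke hs [(1,6),(2,3)] [4,5]
                  [(1,2),(1,3),(2,6),(3,6)]
                  (by simp [*]) (by simp [*]) (by decide +kernel)
              · exact hG.wke hs [(1,4),(2,3)] [4,5]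
                  [(1,2),(1,3),(1,6),(2,6),(3,6)]
                  (by simp [*]) (by simp [*]) (by decide +kernel)
          · by_cases h16 : G.Adj (f 1) (f 6)
            · by_cases h34 : G.Adj (f 3) (f 4)
              · exact hG.wke hs [(1,6),(2,5),(3,4)] [1,2,4]
                  [(3,5),(3,6),(5,6)]
                  (by simp [*]) (by simp [*]) (by decide +kernel)
              · by_cases h45 : G.Adj (f 4) (f 5)
                · exact hG.wke hs [(1,6),(2,3),(4,5)] [1,2,4]
                    [(3,5),(3,6),(5,6)]
                    (by simp [*]) (by simp [*]) (by decide +kernel)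
                · by_cases h46 : G.Adj (f 4) (f 6)
                  · exact hG.wke hs [(2,3),(4,6)] [1,2]
                      [(3,4),(3,5),(3,6),(4,5),(5,6)]
                      (by simp [*]) (by simp [*]) (by decide +kernel)
                  · exact hG.wke hs [(1,4),(2,3)] [1,2]
                      [(3,4),(3,5),(3,6),(4,5),(4,6),(5,6)]
                      (by simp [*]) (by simp [*]) (by decide +kernel)
            · by_cases h15 : G.Adj (f 1) (f 5)
              · exact hG.wke hs [(1,5),(2,3)] [2,4]
                  [(1,3),(1,6),(3,5),(3,6),(5,6)]
                  (by simp [*]) (by simp [*]) (by decide +kernel)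
              · exact hG.wke hs [(1,4),(2,3)] [2,4]
                  [(1,3),(1,5),(1,6),(3,5),(3,6),(5,6)]
                  (by simp [*]) (by simp [*]) (by decide +kernel)
      · by_cases h35 : G.Adj (f 3) (f 5)
        · by_cases h26 : G.Adj (f 2) (f 6)
          · exact hG.wke hs [(1,4),(2,6),(3,5)] [1,3,4]
              [(2,5),(5,6)]
              (by simp [*]) (by simp [*]) (by decide +kernel)
          · by_cases h16 : G.Adj (f 1) (f 6)
            · by_cases h24 : G.Adj (f 2) (f 4)
              · exact hG.wke hs [(1,6),(2,4),(3,5)] [1,3,4]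
                  [(2,5),(2,6),(5,6)]
                  (by simp [*]) (by simp [*]) (by decide +kernel)
              · by_cases h45 : G.Adj (f 4) (f 5)
                · exact hG.wke hs [(1,6),(2,3),(4,5)] [1,3,4]
                    [(2,5),(2,6),(5,6)]
                    (by simp [*]) (by simp [*]) (by decide +kernel)
                · by_cases h46 : G.Adj (f 4) (f 6)
                  · exact hG.wke hs [(3,5),(4,6)] [1,3]
                      [(2,4),(2,5),(2,6),(4,5),(5,6)]
                      (by simp [*]) (by simp [*]) (by decide +kernel)
                  · exact hG.wke hs [(1,4),(3,5)] [1,3]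
                      [(2,4),(2,5),(2,6),(4,5),(4,6),(5,6)]
                      (by simp [*]) (by simp [*]) (by decide +kernel)
            · by_cases h15 : G.Adj (f 1) (f 5)
              · exact hG.wke hs [(1,5),(2,3)] [3,4]
                  [(1,2),(1,6),(2,5),(2,6),(5,6)]
                  (by simp [*]) (by simp [*]) (by decide +kernel)
              · exact hG.wke hs [(1,4),(3,5)] [3,4]
                  [(1,2),(1,5),(1,6),(2,5),(2,6),(5,6)]
                  (by simp [*]) (by simp [*]) (by decide +kernel)
        · by_cases h15 : G.Adj (f 1) (f 5)
          · exact hG.wke hs [(1,5),(2,3)] [4,6]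
              [(1,2),(1,3),(2,5),(3,5)]
              (by simp [*]) (by simp [*]) (by decide +kernel)
          · exact hG.wke hs [(1,4),(2,3)] [4,6]
              [(1,2),(1,3),(1,5),(2,5),(3,5)]
              (by simp [*]) (by simp [*]) (by decide +kernel)
  · by_cases h25 : G.Adj (f 2) (f 5)
    · by_cases h36 : G.Adj (f 3) (f 6)
      · exact hG.wke hs [(1,4),(2,5),(3,6)] [4,5,6]
          [(1,2),(1,3),(2,3)]
          (by simp [*]) (by simp [*]) (by decide +kernel)
      · by_cases h16 : G.Adj (f 1) (f 6)
        · by_cases h34 : G.Adj (f 3) (f 4)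
          · exact hG.wke hs [(1,6),(2,5),(3,4)] [2,4,5]
              [(1,3),(3,6)]
              (by simp [*]) (by simp [*]) (by decide +kernel)
          · by_cases h35 : G.Adj (f 3) (f 5)
            · by_cases h26 : G.Adj (f 2) (f 6)
              · exact hG.wke hs [(1,4),(2,6),(3,5)] [1,4,5]
                  [(2,3),(3,6)]
                  (by simp [*]) (by simp [*]) (by decide +kernel)
              · exact hG.wke hs [(1,6),(3,5)] [4,5]
                  [(1,2),(1,3),(2,3),(2,6),(3,6)]
                  (by simp [*]) (by simp [*]) (by decide +kernel)
            · exact hG.iso hs 3 [(1,3),(2,3),(3,4),(3,5),(3,6)] (by simp [*]) (by decide +kernel)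
        · by_cases h26 : G.Adj (f 2) (f 6)
          · exact hG.wke hs [(1,4),(2,6)] [4,5]
              [(1,2),(1,3),(1,6),(2,3),(3,6)]
              (by simp [*]) (by simp [*]) (by decide +kernel)
          · exact hG.wke hs [(1,4),(2,5)] [4,5]
              [(1,2),(1,3),(1,6),(2,3),(2,6),(3,6)]
              (by simp [*]) (by simp [*]) (by decide +kernel)
    · by_cases h26 : G.Adj (f 2) (f 6)
      · by_cases h35 : G.Adj (f 3) (f 5)
        · exact hG.wke hs [(1,4),(2,6),(3,5)] [1,4,6]
            [(2,3),(2,5)]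
            (by simp [*]) (by simp [*]) (by decide +kernel)
        · by_cases h15 : G.Adj (f 1) (f 5)
          · exact hG.wke hs [(1,5),(2,6)] [4,6]
              [(1,2),(1,3),(2,3),(2,5),(3,5)]
              (by simp [*]) (by simp [*]) (by decide +kernel)
          · exact hG.wke hs [(1,4),(2,6)] [4,6]
              [(1,2),(1,3),(1,5),(2,3),(2,5),(3,5)]
              (by simp [*]) (by simp [*]) (by decide +kernel)
      · by_cases h24 : G.Adj (f 2) (f 4)
        · by_cases h35 : G.Adj (f 3) (f 5)
          · by_cases h16 : G.Adj (f 1) (f 6)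
            · exact hG.wke hs [(1,6),(2,4),(3,5)] [1,4,6]
                [(2,3),(2,5)]
                (by simp [*]) (by simp [*]) (by decide +kernel)
            · by_cases h36 : G.Adj (f 3) (f 6)
              · exact hG.wke hs [(2,4),(3,6)] [4,5]
                  [(1,2),(1,3),(1,6),(2,3),(2,6)]
                  (by simp [*]) (by simp [*]) (by decide +kernel)
              · exact hG.wke hs [(2,4),(3,5)] [4,5]
                  [(1,2),(1,3),(1,6),(2,3),(2,6),(3,6)]
                  (by simp [*]) (by simp [*]) (by decide +kernel)
          · by_cases h15 : G.Adj (f 1) (f 5)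
            · exact hG.wke hs [(1,5),(2,4)] [4,6]
                [(1,2),(1,3),(2,3),(2,5),(3,5)]
                (by simp [*]) (by simp [*]) (by decide +kernel)
            · by_cases h36 : G.Adj (f 3) (f 6)
              · exact hG.wke hs [(2,4),(3,6)] [4,6]
                  [(1,2),(1,3),(1,5),(2,3),(2,5),(3,5)]
                  (by simp [*]) (by simp [*]) (by decide +kernel)
              · by_cases h56 : G.Adj (f 5) (f 6)
                · exact hG.wke hs [(2,4),(5,6)] [1,4]
                    [(2,3),(2,5),(2,6),(3,5),(3,6)]
                    (by simp [*]) (by simp [*]) (by decide +kernel)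
                · by_cases h16 : G.Adj (f 1) (f 6)
                  · exact hG.wke hs [(1,6)] [4]
                      [(1,2),(1,3),(1,5),(2,3),(2,5),(2,6),(3,5),(3,6),(5,6)]
                      (by simp [*]) (by simp [*]) (by decide +kernel)
                  · exact hG.wke hs [(2,4)] [4]
                      [(1,2),(1,3),(1,5),(1,6),(2,3),(2,5),(2,6),(3,5),(3,6),(5,6)]
                      (by simp [*]) (by simp [*]) (by decide +kernel)
        · exact hG.iso hs 2 [(1,2),(2,3),(2,4),(2,5),(2,6)] (by simp [*]) (by decide +kernel)

lemma CritG.min_degree [Fintype V] [DecidableEq V] {G : SimpleGraph V} [DecidableRel G.Adj]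
    (hG : CritG G) {v w : V} (hvw : G.Adj v w) : 5 ≤ G.degree v := by
  obtain ⟨p, hvp, hwp⟩ := hG.triangle hvw
  by_contra hcon
  have hsub : ({w, p} : Finset V) ⊆ G.neighborFinset v := by
    intro a ha
    simp only [Finset.mem_insert, Finset.mem_singleton] at ha
    rw [SimpleGraph.mem_neighborFinset]
    rcases ha with rfl | rfl <;> assumption
  have hcd : (G.neighborFinset v \ {w, p}).card = G.degree v - 2 := by
    rw [Finset.card_sdiff_of_subset hsub, Finset.card_pair hwp.ne]
    rfl
  have h2 : 2 ≤ G.degree v := by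
    have := Finset.card_le_card hsub
    rwa [Finset.card_pair hwp.ne] at this
  have hr : ∀ a, G.Adj v a ↔ a = w ∨ a = p ∨ a ∈ G.neighborFinset v \ {w, p} := by
    intro a
    simp only [Finset.mem_sdiff, SimpleGraph.mem_neighborFinset, Finset.mem_insert,
      Finset.mem_singleton]
    constructor
    · tauto
    · rintro (rfl | rfl | h)
      · exact hvw
      · exact hvp
      · exact h.1
  have h3 : G.degree v = 2 ∨ G.degree v = 3 ∨ G.degree v = 4 := by omega
  rcases h3 with hd | hd | hd
  · rw [hd, Finset.card_eq_zero] at hcd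
    refine hG.star2 (StarF.mk' (v := v) ![w, p] hd (by norm_num) ?_) (by simpa using hwp)
    intro a
    rw [hr, hcd]
    simp [Fin.exists_fin_succ, eq_comm]
  · rw [hd, Finset.card_eq_one] at hcd
    obtain ⟨q, hq⟩ := hcd
    refine hG.star3 (StarF.mk' (v := v) ![w, p, q] hd (by norm_num) ?_) (by simpa using hwp)
    intro a
    rw [hr, hq]
    simp [Fin.exists_fin_succ, eq_comm]
  · rw [hd, Finset.card_eq_two] at hcd
    obtain ⟨q, r, -, hq⟩ := hcd
    refine hG.star4 (StarF.mk' (v := v) ![w, p, q, r] hd (by norm_num) ?_) (by simpa using hwp)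
    intro a
    rw [hr, hq]
    simp [Fin.exists_fin_succ, eq_comm]

lemma CritG.cm [Fintype V] [DecidableEq V] {G : SimpleGraph V} [DecidableRel G.Adj]
    (hG : CritG G) {v : V} (hd : G.degree v ≤ 6) {x y z : V} (hx : G.Adj v x) (hy : G.Adj v y)
    (hz : G.Adj v z) (hxy : x ≠ y) (hxz : x ≠ z) (hyz : y ≠ z) : G.Adj x y ∨ G.Adj x z := by
  by_contra hno
  push Not at hno
  obtain ⟨p, hvp, hxp⟩ := hG.triangle hx
  have hpy : p ≠ y := fun h => hno.1 (h ▸ hxp)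
  have hpz : p ≠ z := fun h => hno.2 (h ▸ hxp)
  have h5 := hG.min_degree hx
  have hsub : ({x, y, z, p} : Finset V) ⊆ G.neighborFinset v := by
    intro a ha
    simp only [Finset.mem_insert, Finset.mem_singleton] at ha
    rw [SimpleGraph.mem_neighborFinset]
    rcases ha with rfl | rfl | rfl | rfl <;> assumption
  have h4 : ({x, y, z, p} : Finset V).card = 4 := by
    rw [Finset.card_insert_of_notMem, Finset.card_insert_of_notMem, Finset.card_pair hpz.symm]
    · simp [hyz, hpy.symm]
    · simp [hxy, hxz, hxp.ne]
  have hcd : (G.neighborFinset v \ {x, y, z, p}).card = G.degree v - 4 := by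
    rw [Finset.card_sdiff_of_subset hsub, h4]
    rfl
  have hr : ∀ a, G.Adj v a ↔ a = x ∨ a = y ∨ a = z ∨ a = p ∨
      a ∈ G.neighborFinset v \ {x, y, z, p} := by
    intro a
    simp only [Finset.mem_sdiff, SimpleGraph.mem_neighborFinset, Finset.mem_insert,
      Finset.mem_singleton]
    constructor
    · tauto
    · rintro (rfl | rfl | rfl | rfl | h)
      · exact hx
      · exact hy
      · exact hz
      · exact hvp
      · exact h.1
  have h3 : G.degree v = 5 ∨ G.degree v = 6 := by omega
  rcases h3 with hd | hd
  · rw [hd, Finset.card_eq_one] at hcd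
    obtain ⟨q, hq⟩ := hcd
    refine hG.star5 (StarF.mk' (v := v) ![x, y, z, p, q] hd (by norm_num) ?_)
      (by simpa using hno.1) (by simpa using hno.2) (by simpa using hxp)
    intro a
    rw [hr, hq]
    simp [Fin.exists_fin_succ, eq_comm]
  · rw [hd, Finset.card_eq_two] at hcd
    obtain ⟨q, r, -, hq⟩ := hcd
    refine hG.star6 (StarF.mk' (v := v) ![x, y, z, p, q, r] hd (by norm_num) ?_)
      (by simpa using hno.1) (by simpa using hno.2) (by simpa using hxp)
    intro a
    rw [hr, hq]
    simp [Fin.exists_fin_succ, eq_comm]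

lemma label4 [DecidableEq V] {G : SimpleGraph V} {C : Finset V} (hC : C.card = 4)
    (h : ∀ x ∈ C, ∀ y ∈ C, ∀ z ∈ C, x ≠ y → x ≠ z → y ≠ z → G.Adj x y ∨ G.Adj x z) :
    ∃ a b c d, C = {a, b, c, d} ∧ [a, b, c, d].Nodup ∧ G.Adj a c ∧ G.Adj a d ∧
      G.Adj b c ∧ G.Adj b d := by
  obtain ⟨p, hp⟩ := Finset.card_pos.1 (by omega : 0 < C.card)
  have h3 : (C.erase p).card = 3 := by rw [Finset.card_erase_of_mem hp, hC]
  obtain ⟨q, r, s, hqr, hqs, hrs, he⟩ := Finset.card_eq_three.1 h3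
  have hCe : C = {p, q, r, s} := by rw [← he, Finset.insert_erase hp]
  have hpq : p ≠ q := by
    rintro rfl
    exact Finset.notMem_erase p C (by rw [he]; simp)
  have hpr : p ≠ r := by
    rintro rfl
    exact Finset.notMem_erase p C (by rw [he]; simp)
  have hps : p ≠ s := by
    rintro rfl
    exact Finset.notMem_erase p C (by rw [he]; simp)
  have mq : q ∈ C := by rw [hCe]; simp
  have mr : r ∈ C := by rw [hCe]; simp
  have ms : s ∈ C := by rw [hCe]; simp
  have key : (G.Adj p r ∧ G.Adj p s ∧ G.Adj q r ∧ G.Adj q s) ∨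
      (G.Adj p q ∧ G.Adj p s ∧ G.Adj r q ∧ G.Adj r s) ∨
      (G.Adj p q ∧ G.Adj p r ∧ G.Adj s q ∧ G.Adj s r) := by
    have e1 := G.adj_comm p q
    have e2 := G.adj_comm p r
    have e3 := G.adj_comm p s
    have e4 := G.adj_comm q r
    have e5 := G.adj_comm q s
    have e6 := G.adj_comm r s
    have a1 := h p hp q mq r mr hpq hpr hqr
    have a2 := h p hp q mq s ms hpq hps hqs
    have a3 := h p hp r mr s ms hpr hps hrs
    have b1 := h q mq p hp r mr hpq.symm hqr hpr
    have b2 := h q mq p hp s ms hpq.symm hqs hps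
    have b3 := h q mq r mr s ms hqr hqs hrs
    have c1 := h r mr p hp q mq hpr.symm hqr.symm hpq
    have c2 := h r mr p hp s ms hpr.symm hrs hps
    have c3 := h r mr q mq s ms hqr.symm hrs hqs
    have d1 := h s ms p hp q mq hps.symm hqs.symm hpq
    have d2 := h s ms p hp r mr hps.symm hrs.symm hpr
    have d3 := h s ms q mq r mr hqs.symm hrs.symm hqr
    clear h
    grind
  rcases key with ⟨k1, k2, k3, k4⟩ | ⟨k1, k2, k3, k4⟩ | ⟨k1, k2, k3, k4⟩
  · exact ⟨p, q, r, s, hCe, by simp [*], k1, k2, k3, k4⟩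
  · exact ⟨p, r, q, s, by rw [hCe, Finset.insert_comm q r], by simp [*, hqr.symm], k1, k2, k3, k4⟩
  · refine ⟨p, s, q, r, ?_, by simp [*, hqs.symm, hrs.symm], k1, k2, k3, k4⟩
    rw [hCe]
    ext x
    simp only [Finset.mem_insert, Finset.mem_singleton]
    tauto

lemma label3 [DecidableEq V] {G : SimpleGraph V} {C : Finset V} (hC : C.card = 3)
    (h : ∀ x ∈ C, ∀ y ∈ C, ∀ z ∈ C, x ≠ y → x ≠ z → y ≠ z → G.Adj x y ∨ G.Adj x z) :
    ∃ a b c, C = {a, b, c} ∧ [a, b, c].Nodup ∧ G.Adj a c ∧ G.Adj b c := by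
  obtain ⟨q, r, s, hqr, hqs, hrs, he⟩ := Finset.card_eq_three.1 hC
  have mq : q ∈ C := by rw [he]; simp
  have mr : r ∈ C := by rw [he]; simp
  have ms : s ∈ C := by rw [he]; simp
  have b3 := h q mq r mr s ms hqr hqs hrs
  have c3 := h r mr q mq s ms hqr.symm hrs hqs
  have d3 := h s ms q mq r mr hqs.symm hrs.symm hqr
  by_cases k : G.Adj q s
  · by_cases k' : G.Adj r s
    · exact ⟨q, r, s, he, by simp [*], k, k'⟩
    · refine ⟨r, s, q, ?_, by simp [*, hqr.symm, hqs.symm], ?_, k.symm⟩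
      · rw [he]
        ext x
        simp only [Finset.mem_insert, Finset.mem_singleton]
        tauto
      · tauto
  · refine ⟨q, s, r, ?_, by simp [*, hrs.symm], ?_, ?_⟩
    · rw [he]
      ext x
      simp only [Finset.mem_insert, Finset.mem_singleton]
      tauto
    · tauto
    · have := G.adj_comm q s
      tauto

lemma inj_of_nodup {n : ℕ} {f : Fin n → V} (h : (List.ofFn f).Nodup) : Function.Injective f :=
  List.nodup_ofFn.1 h

lemma CritG.pair [DecidableEq V] {G : SimpleGraph V} (hG : CritG G) {n : ℕ}
    {f : Fin (n + 2) → V} (hnd : (List.ofFn f).Nodup) (h01 : G.Adj (f 0) (f 1))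
    (h0 : ∀ w, G.Adj (f 0) w → w ∈ List.ofFn f) (h1 : ∀ w, G.Adj (f 1) w → w ∈ List.ofFn f)
    (S : List (Fin (n + 2) × Fin (n + 2) × Fin (n + 2))) (X N : List (Fin (n + 2) × Fin (n + 2)))
    (hS : ∀ t ∈ S, G.Adj (f t.1) (f t.2.1) ∧ G.Adj (f t.1) (f t.2.2) ∧ G.Adj (f t.2.1) (f t.2.2))
    (hN : ∀ p ∈ N, ¬ G.Adj (f p.1) (f p.2))
    (hc : RCheck (n + 2) [0, 1] S X N) : False := by
  refine hG.reduceFin (inj_of_nodup hnd) [0, 1] S X N ?_ ?_ hS hN hc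
  · intro i hi w hw
    simp only [List.mem_cons, List.not_mem_nil, or_false] at hi
    rcases hi with rfl | rfl
    · exact List.mem_ofFn.1 (h0 w hw)
    · exact List.mem_ofFn.1 (h1 w hw)
  · intro i hi
    simp only [List.mem_cons, List.not_mem_nil, or_false] at hi
    rcases hi with rfl | rfl
    · exact ⟨_, h01⟩
    · exact ⟨_, h01.symm⟩

set_option maxHeartbeats 4000000 in
lemma CritG.low_indep_aux [Fintype V] [DecidableEq V] {G : SimpleGraph V} [DecidableRel G.Adj]
    (hG : CritG G) {u v : V} (huv : G.Adj u v) (hle : G.degree u ≤ G.degree v)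
    (hv : G.degree v ≤ 6) : False := by
  have hu : G.degree u ≤ 6 := hle.trans hv
  have h5 := hG.min_degree huv
  let C := G.neighborFinset u ∩ G.neighborFinset v
  let A := G.neighborFinset u \ insert v (G.neighborFinset v)
  let B := G.neighborFinset v \ insert u (G.neighborFinset u)
  have mC : ∀ x, x ∈ C ↔ G.Adj u x ∧ G.Adj v x := by intro x; simp [C]
  have mA : ∀ x, x ∈ A ↔ G.Adj u x ∧ x ≠ v ∧ ¬ G.Adj v x := by intro x; simp [A]
  have mB : ∀ x, x ∈ B ↔ G.Adj v x ∧ x ≠ u ∧ ¬ G.Adj u x := by intro x; simp [B]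
  have hA1 : A.card ≤ 1 := by
    rw [Finset.card_le_one]
    intro e he e' he'
    rw [mA] at he he'
    by_contra hne
    rcases hG.cm hu huv he.1 he'.1 he.2.1.symm he'.2.1.symm hne with h | h
    · exact he.2.2 h
    · exact he'.2.2 h
  have hB1 : B.card ≤ 1 := by
    rw [Finset.card_le_one]
    intro e he e' he'
    rw [mB] at he he'
    by_contra hne
    rcases hG.cm hv huv.symm he.1 he'.1 he.2.1.symm he'.2.1.symm hne with h | h
    · exact he.2.2 h
    · exact he'.2.2 h
  have cu : G.degree u = 1 + C.card + A.card := by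
    have e : G.neighborFinset u = insert v (C ∪ A) := by
      ext x
      simp only [Finset.mem_insert, Finset.mem_union, mC, mA, SimpleGraph.mem_neighborFinset]
      constructor
      · tauto
      · rintro (rfl | h | h)
        · exact huv
        · exact h.1
        · exact h.1
    rw [← SimpleGraph.card_neighborFinset_eq_degree, e, Finset.card_insert_of_notMem,
      Finset.card_union_of_disjoint]
    · omega
    · rw [Finset.disjoint_left]
      intro x hx hx'
      rw [mC] at hx
      rw [mA] at hx'
      exact hx'.2.2 hx.2
    · simp [mC, mA]
  have cv : G.degree v = 1 + C.card + B.card := by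
    have e : G.neighborFinset v = insert u (C ∪ B) := by
      ext x
      simp only [Finset.mem_insert, Finset.mem_union, mC, mB, SimpleGraph.mem_neighborFinset]
      constructor
      · tauto
      · rintro (rfl | h | h)
        · exact huv.symm
        · exact h.2
        · exact h.1
    rw [← SimpleGraph.card_neighborFinset_eq_degree, e, Finset.card_insert_of_notMem,
      Finset.card_union_of_disjoint]
    · omega
    · rw [Finset.disjoint_left]
      intro x hx hx'
      rw [mC] at hx
      rw [mB] at hx'
      exact hx'.2.2 hx.1
    · simp [mC, mB]
  have hCC : ∀ x ∈ C, ∀ y ∈ C, ∀ z ∈ C, x ≠ y → x ≠ z → y ≠ z → G.Adj x y ∨ G.Adj x z := by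
    intro x hx y hy z hz
    rw [mC] at hx hy hz
    exact hG.cm hu hx.1 hy.1 hz.1
  have hAC : ∀ e ∈ A, ∀ x ∈ C, G.Adj x e := by
    intro e he x hx
    rw [mC] at hx
    rw [mA] at he
    have hex : e ≠ x := by rintro rfl; exact he.2.2 hx.2
    rcases hG.cm hu he.1 huv hx.1 he.2.1 hex hx.2.ne with h | h
    · exact absurd h.symm he.2.2
    · exact h.symm
  have hBC : ∀ e ∈ B, ∀ x ∈ C, G.Adj x e := by
    intro e he x hx
    rw [mC] at hx
    rw [mB] at he
    have hex : e ≠ x := by rintro rfl; exact he.2.2 hx.1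
    rcases hG.cm hv he.1 huv.symm hx.2 he.2.1 hex hx.1.ne with h | h
    · exact absurd h.symm he.2.2
    · exact h.symm
  have clu : ∀ w, G.Adj u w → w = v ∨ w ∈ C ∨ w ∈ A := by
    intro w hw
    rw [mC, mA]
    tauto
  have clv : ∀ w, G.Adj v w → w = u ∨ w ∈ C ∨ w ∈ B := by
    intro w hw
    rw [mC, mB]
    tauto
  clear_value A B C
  have cases5 : (C.card = 4 ∧ A.card = 0 ∧ B.card = 0) ∨ (C.card = 4 ∧ A.card = 0 ∧ B.card = 1) ∨
      (C.card = 3 ∧ A.card = 1 ∧ B.card = 1) ∨ (C.card = 5 ∧ A.card = 0 ∧ B.card = 0) ∨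
      (C.card = 4 ∧ A.card = 1 ∧ B.card = 1) := by omega
  rcases cases5 with ⟨c1, c2, c3⟩ | ⟨c1, c2, c3⟩ | ⟨c1, c2, c3⟩ | ⟨c1, c2, c3⟩ | ⟨c1, c2, c3⟩
  · obtain ⟨a, b, c, d, rfl, hnd, hac, had, hbc, hbd⟩ := label4 c1 hCC
    obtain rfl := Finset.card_eq_zero.1 c2
    obtain rfl := Finset.card_eq_zero.1 c3
    have ma := (mC a).1 (by simp)
    have mb := (mC b).1 (by simp)
    have mc := (mC c).1 (by simp)
    have md := (mC d).1 (by simp)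
    refine hG.pair (f := ![u, v, a, b, c, d]) ?_ (by simpa using huv) ?_ ?_
      [(0,2,4),(0,3,5),(1,2,5),(1,3,4)]
      [(2,4),(3,5),(2,5),(3,4),(0,1),(2,3),(4,5)] []
      (by simp [*]) (by simp [*]) (by decide +kernel)
    · have := huv.ne
      have := ma.1.ne
      have := ma.2.ne
      have := mb.1.ne
      have := mb.2.ne
      have := mc.1.ne
      have := mc.2.ne
      have := md.1.ne
      have := md.2.ne
      clear hCC hAC hBC clu clv mA mB mC
      simp [List.ofFn_succ] at hnd ⊢
      grind
    · intro w hw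
      have := clu w hw
      simp at this
      simp [List.ofFn_succ]
      tauto
    · intro w hw
      have := clv w hw
      simp at this
      simp [List.ofFn_succ]
      tauto
  · obtain ⟨a, b, c, d, rfl, hnd, hac, had, hbc, hbd⟩ := label4 c1 hCC
    obtain rfl := Finset.card_eq_zero.1 c2
    obtain ⟨e, rfl⟩ := Finset.card_eq_one.1 c3
    have ma := (mC a).1 (by simp)
    have mb := (mC b).1 (by simp)
    have mc := (mC c).1 (by simp)
    have md := (mC d).1 (by simp)
    have me := (mB e).1 (by simp)
    have kae := hBC e (by simp) a (by simp)
    have kbe := hBC e (by simp) b (by simp)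
    have kce := hBC e (by simp) c (by simp)
    have kde := hBC e (by simp) d (by simp)
    refine hG.pair (f := ![u, v, a, b, c, d, e]) ?_ (by simpa using huv) ?_ ?_
      [(0,2,4),(0,3,5),(1,2,5),(1,3,4)]
      [(2,4),(3,5),(2,5),(3,4),(0,1),(2,3),(4,5),(1,6)] [(0,6)]
      (by simp [*]) (by simp [*]) (by decide +kernel)
    · have := huv.ne
      have := ma.1.ne
      have := ma.2.ne
      have := mb.1.ne
      have := mb.2.ne
      have := mc.1.ne
      have := mc.2.ne
      have := md.1.ne
      have := md.2.ne
      have := me.1.ne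
      have := me.2.1
      have := kae.ne
      have := kbe.ne
      have := kce.ne
      have := kde.ne
      clear hCC hAC hBC clu clv mA mB mC
      simp [List.ofFn_succ] at hnd ⊢
      grind
    · intro w hw
      have := clu w hw
      simp at this
      simp [List.ofFn_succ]
      tauto
    · intro w hw
      have := clv w hw
      simp at this
      simp [List.ofFn_succ]
      tauto
  · obtain ⟨a, b, c, rfl, hnd, hac, hbc⟩ := label3 c1 hCC
    obtain ⟨e, rfl⟩ := Finset.card_eq_one.1 c2
    obtain ⟨d, rfl⟩ := Finset.card_eq_one.1 c3
    have ma := (mC a).1 (by simp)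
    have mb := (mC b).1 (by simp)
    have mc := (mC c).1 (by simp)
    have me := (mA e).1 (by simp)
    have kae := hAC e (by simp) a (by simp)
    have kbe := hAC e (by simp) b (by simp)
    have kce := hAC e (by simp) c (by simp)
    have md := (mB d).1 (by simp)
    have kad := hBC d (by simp) a (by simp)
    have kbd := hBC d (by simp) b (by simp)
    have kcd := hBC d (by simp) c (by simp)
    refine hG.pair (f := ![u, v, a, b, c, d, e]) ?_ (by simpa using huv) ?_ ?_
      [(1,2,5),(1,3,4),(0,3,6),(0,2,4)]
      [(2,5),(3,4),(3,6),(2,4),(0,1),(2,3),(1,5),(0,6)] [(0,5),(1,6)]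
      (by simp [*]) (by simp [*]) (by decide +kernel)
    · have := huv.ne
      have := ma.1.ne
      have := ma.2.ne
      have := mb.1.ne
      have := mb.2.ne
      have := mc.1.ne
      have := mc.2.ne
      have := me.1.ne
      have := me.2.1
      have := kae.ne
      have := kbe.ne
      have := kce.ne
      have := md.1.ne
      have := md.2.1
      have := kad.ne
      have := kbd.ne
      have := kcd.ne
      have : e ≠ d := fun h => me.2.2 (h ▸ md.1)
      clear hCC hAC hBC clu clv mA mB mC
      simp [List.ofFn_succ] at hnd ⊢
      grind
    · intro w hw
      have := clu w hw
      simp at this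
      simp [List.ofFn_succ]
      tauto
    · intro w hw
      have := clv w hw
      simp at this
      simp [List.ofFn_succ]
      tauto
  · obtain ⟨e, he⟩ := Finset.card_pos.1 (by omega : 0 < C.card)
    obtain ⟨a, b, c, d, hCe, hnd, hac, had, hbc, hbd⟩ := label4 (C := C.erase e)
      (by rw [Finset.card_erase_of_mem he, c1]) (fun x hx y hy z hz =>
        hCC x (Finset.mem_of_mem_erase hx) y (Finset.mem_of_mem_erase hy) z (Finset.mem_of_mem_erase hz))
    have hne : e ∉ C.erase e := Finset.notMem_erase e C
    rw [hCe] at hne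
    obtain rfl : C = {e, a, b, c, d} := by rw [← hCe, Finset.insert_erase he]
    obtain rfl := Finset.card_eq_zero.1 c2
    obtain rfl := Finset.card_eq_zero.1 c3
    have ma := (mC a).1 (by simp)
    have mb := (mC b).1 (by simp)
    have mc := (mC c).1 (by simp)
    have md := (mC d).1 (by simp)
    have me := (mC e).1 (by simp)
    refine hG.pair (f := ![u, v, a, b, c, d, e]) ?_ (by simpa using huv) ?_ ?_
      [(0,2,4),(0,3,5),(1,2,5),(1,3,4),(0,1,6)]
      [(2,4),(3,5),(2,5),(3,4),(0,1),(2,3),(4,5),(0,6),(1,6)] []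
      (by simp [*]) (by simp [*]) (by decide +kernel)
    · have := huv.ne
      have := ma.1.ne
      have := ma.2.ne
      have := mb.1.ne
      have := mb.2.ne
      have := mc.1.ne
      have := mc.2.ne
      have := md.1.ne
      have := md.2.ne
      have := me.1.ne
      have := me.2.ne
      simp at hne
      clear hCC hAC hBC clu clv mA mB mC
      simp [List.ofFn_succ] at hnd ⊢
      grind
    · intro w hw
      have := clu w hw
      simp at this
      simp [List.ofFn_succ]
      tauto
    · intro w hw
      have := clv w hw
      simp at this
      simp [List.ofFn_succ]
      tauto
  · obtain ⟨a, b, c, d, rfl, hnd, hac, had, hbc, hbd⟩ := label4 c1 hCC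
    obtain ⟨e, rfl⟩ := Finset.card_eq_one.1 c2
    obtain ⟨g, rfl⟩ := Finset.card_eq_one.1 c3
    have ma := (mC a).1 (by simp)
    have mb := (mC b).1 (by simp)
    have mc := (mC c).1 (by simp)
    have md := (mC d).1 (by simp)
    have me := (mA e).1 (by simp)
    have kae := hAC e (by simp) a (by simp)
    have kbe := hAC e (by simp) b (by simp)
    have kce := hAC e (by simp) c (by simp)
    have kde := hAC e (by simp) d (by simp)
    have mg := (mB g).1 (by simp)
    have kag := hBC g (by simp) a (by simp)
    have kbg := hBC g (by simp) b (by simp)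
    have kcg := hBC g (by simp) c (by simp)
    have kdg := hBC g (by simp) d (by simp)
    refine hG.pair (f := ![u, v, a, b, c, d, e, g]) ?_ (by simpa using huv) ?_ ?_
      [(0,1,5),(0,2,6),(0,3,4),(1,3,7),(1,2,4)]
      [(2,6),(3,4),(3,7),(2,4),(0,1),(0,6),(0,5),(1,7),(1,5),(2,3)] [(0,7),(1,6)]
      (by simp [*]) (by simp [*]) (by decide +kernel)
    · have := huv.ne
      have := ma.1.ne
      have := ma.2.ne
      have := mb.1.ne
      have := mb.2.ne
      have := mc.1.ne
      have := mc.2.ne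
      have := md.1.ne
      have := md.2.ne
      have := me.1.ne
      have := me.2.1
      have := kae.ne
      have := kbe.ne
      have := kce.ne
      have := kde.ne
      have := mg.1.ne
      have := mg.2.1
      have := kag.ne
      have := kbg.ne
      have := kcg.ne
      have := kdg.ne
      have : e ≠ g := fun h => me.2.2 (h ▸ mg.1)
      clear hCC hAC hBC clu clv mA mB mC
      simp [List.ofFn_succ] at hnd ⊢
      grind
    · intro w hw
      have := clu w hw
      simp at this
      simp [List.ofFn_succ]
      tauto
    · intro w hw
      have := clv w hw
      simp at this
      simp [List.ofFn_succ]
      tauto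

lemma CritG.low_indep [Fintype V] [DecidableEq V] {G : SimpleGraph V} [DecidableRel G.Adj]
    (hG : CritG G) {u v : V} (huv : G.Adj u v) (hu : G.degree u ≤ 6)
    (hv : G.degree v ≤ 6) : False := by
  rcases le_total (G.degree u) (G.degree v) with h | h
  · exact hG.low_indep_aux huv h hv
  · exact hG.low_indep_aux huv.symm h hu

lemma CritG.common3 [Fintype V] [DecidableEq V] {G : SimpleGraph V} [DecidableRel G.Adj]
    (hG : CritG G) {u v : V} (huv : G.Adj u v) (hu : G.degree u ≤ 6) :
    3 ≤ (G.neighborFinset u ∩ G.neighborFinset v).card := by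
  have h5 := hG.min_degree huv
  have hA1 : (G.neighborFinset u \ insert v (G.neighborFinset v)).card ≤ 1 := by
    rw [Finset.card_le_one]
    intro e he e' he'
    simp only [Finset.mem_sdiff, Finset.mem_insert, SimpleGraph.mem_neighborFinset, not_or]
      at he he'
    by_contra hne
    rcases hG.cm hu huv he.1 he'.1 (Ne.symm he.2.1) (Ne.symm he'.2.1) hne with h | h
    · exact he.2.2 h
    · exact he'.2.2 h
  have hsub : G.neighborFinset u ⊆ insert v ((G.neighborFinset u ∩ G.neighborFinset v) ∪
      (G.neighborFinset u \ insert v (G.neighborFinset v))) := by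
    intro x hx
    simp only [Finset.mem_sdiff, Finset.mem_insert, Finset.mem_union, Finset.mem_inter,
      SimpleGraph.mem_neighborFinset] at hx ⊢
    tauto
  have h1 := Finset.card_le_card hsub
  have h2 := Finset.card_insert_le v ((G.neighborFinset u ∩ G.neighborFinset v) ∪
      (G.neighborFinset u \ insert v (G.neighborFinset v)))
  have h3 := Finset.card_union_le (G.neighborFinset u ∩ G.neighborFinset v)
      (G.neighborFinset u \ insert v (G.neighborFinset v))
  rw [SimpleGraph.card_neighborFinset_eq_degree] at h1
  omega

lemma CritG.star7 [DecidableEq V] {G : SimpleGraph V} (hG : CritG G) {f : Fin 8 → V}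
    (hs : StarF G f) (h12 : ¬ G.Adj (f 1) (f 2)) (h13 : ¬ G.Adj (f 1) (f 3))
    (h14 : ¬ G.Adj (f 1) (f 4)) (h23 : ¬ G.Adj (f 2) (f 3)) (h24 : ¬ G.Adj (f 2) (f 4))
    (h34 : ¬ G.Adj (f 3) (f 4)) (h15 : G.Adj (f 1) (f 5)) (h26 : G.Adj (f 2) (f 6))
    (h37 : G.Adj (f 3) (f 7)) : False :=
  hG.wke hs [(1,5),(2,6),(3,7)] [5,6,7] [(1,2),(1,3),(1,4),(2,3),(2,4),(3,4)]
    (by simp [*]) (by simp [*]) (by decide +kernel)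

lemma CritG.low_nbrs [Fintype V] [DecidableEq V] {G : SimpleGraph V} [DecidableRel G.Adj]
    (hG : CritG G) {v : V} (hv : 7 ≤ G.degree v) :
    25 + ((G.neighborFinset v).filter (fun u => G.degree u ≤ 6)).card ≤ 4 * G.degree v := by
  obtain ⟨L, hL⟩ : ∃ L, L = (G.neighborFinset v).filter (fun u => G.degree u ≤ 6) := ⟨_, rfl⟩
  obtain ⟨K, hK⟩ : ∃ K, K = (G.neighborFinset v).filter (fun u => ¬ G.degree u ≤ 6) := ⟨_, rfl⟩
  have hsum : L.card + K.card = G.degree v := by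
    rw [hL, hK, Finset.card_filter_add_card_filter_not]
    rfl
  have mL : ∀ u, u ∈ L ↔ G.Adj v u ∧ G.degree u ≤ 6 := by intro u; simp [hL]
  have mK : ∀ u, u ∈ K ↔ G.Adj v u ∧ ¬ G.degree u ≤ 6 := by intro u; simp [hK]
  rw [← hL]
  have hsub : ∀ u ∈ L, G.neighborFinset u ∩ G.neighborFinset v ⊆ K := by
    intro u hu x hx
    rw [mL] at hu
    rw [Finset.mem_inter, SimpleGraph.mem_neighborFinset, SimpleGraph.mem_neighborFinset] at hx
    rw [mK]
    exact ⟨hx.2, fun h => hG.low_indep hx.1 hu.2 h⟩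
  have h3 : ∀ u ∈ L, 3 ≤ (G.neighborFinset u ∩ G.neighborFinset v).card := by
    intro u hu
    rw [mL] at hu
    exact hG.common3 hu.1.symm hu.2
  rcases Finset.eq_empty_or_nonempty L with he | ⟨u, hu⟩
  · simp [he]
    omega
  have hK3 : 3 ≤ K.card := (h3 u hu).trans (Finset.card_le_card (hsub u hu))
  by_contra hcon
  have hd7 : G.degree v = 7 := by omega
  have hL4 : L.card = 4 := by omega
  have hK3' : K.card = 3 := by omega
  have hfull : ∀ u ∈ L, ∀ x ∈ K, G.Adj u x := by
    intro u hu x hx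
    have := Finset.eq_of_subset_of_card_le (hsub u hu) (by rw [hK3']; exact h3 u hu)
    rw [← this, Finset.mem_inter, SimpleGraph.mem_neighborFinset] at hx
    exact hx.1
  have hind : ∀ x ∈ L, ∀ y ∈ L, ¬ G.Adj x y := by
    intro x hx y hy h
    rw [mL] at hx hy
    exact hG.low_indep h hx.2 hy.2
  have hr : ∀ w, G.Adj v w ↔ w ∈ L ∨ w ∈ K := by
    intro w
    rw [mL, mK]
    tauto
  have hLe : (L.erase u).card = 3 := by rw [Finset.card_erase_of_mem hu, hL4]
  obtain ⟨b, c, d, -, -, -, he⟩ := Finset.card_eq_three.1 hLe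
  obtain ⟨p, q, r, -, -, -, hKe⟩ := Finset.card_eq_three.1 hK3'
  have hLe' : L = {u, b, c, d} := by rw [← he, Finset.insert_erase hu]
  have mb : b ∈ L := by rw [hLe']; simp
  have mc : c ∈ L := by rw [hLe']; simp
  have md : d ∈ L := by rw [hLe']; simp
  have mp : p ∈ K := by rw [hKe]; simp
  have mq : q ∈ K := by rw [hKe]; simp
  have mr : r ∈ K := by rw [hKe]; simp
  refine hG.star7 (StarF.mk' (v := v) ![u, b, c, d, p, q, r] hd7 (by norm_num) ?_)
    (hind u hu b mb) (hind u hu c mc) (hind u hu d md) (hind b mb c mc) (hind b mb d md)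
    (hind c mc d md) (hfull u hu p mp) (hfull b mb q mq) (hfull c mc r mr)
  intro a
  rw [hr, hLe', hKe]
  simp [Fin.exists_fin_succ, eq_comm, or_assoc]

lemma CritG.discharge [Fintype V] [DecidableEq V] {G : SimpleGraph V} [DecidableRel G.Adj]
    (hG : CritG G) :
    25 * (Finset.univ.filter (fun v => 0 < G.degree v)).card ≤ 4 * ∑ v, G.degree v := by
  obtain ⟨Lo, hLo⟩ : ∃ L : Finset V, L = Finset.univ.filter
    (fun v => 0 < G.degree v ∧ G.degree v ≤ 6) := ⟨_, rfl⟩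
  obtain ⟨Hi, hHi⟩ : ∃ L : Finset V, L = Finset.univ.filter (fun v => 7 ≤ G.degree v) := ⟨_, rfl⟩
  have mLo : ∀ v, v ∈ Lo ↔ 0 < G.degree v ∧ G.degree v ≤ 6 := by intro v; simp [hLo]
  have mHi : ∀ v, v ∈ Hi ↔ 7 ≤ G.degree v := by intro v; simp [hHi]
  have hdisj : Disjoint Lo Hi := by
    rw [Finset.disjoint_left]
    intro v h1 h2
    rw [mLo] at h1
    rw [mHi] at h2
    omega
  have hP : Finset.univ.filter (fun v => 0 < G.degree v) = Lo ∪ Hi := by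
    ext v
    simp only [Finset.mem_filter, Finset.mem_univ, true_and, Finset.mem_union, mLo, mHi]
    omega
  have hsum : ∑ v ∈ Lo, G.degree v + ∑ v ∈ Hi, G.degree v ≤ ∑ v, G.degree v := by
    rw [← Finset.sum_union hdisj]
    exact Finset.sum_le_sum_of_subset (Finset.subset_univ _)
  have hdc := Finset.sum_card_bipartiteAbove_eq_sum_card_bipartiteBelow (s := Lo) (t := Hi) G.Adj
  have e1 : ∀ u ∈ Lo, (Finset.bipartiteAbove G.Adj Hi u).card = G.degree u := by
    intro u hu
    rw [mLo] at hu
    rw [← SimpleGraph.card_neighborFinset_eq_degree]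
    congr 1
    ext w
    simp only [Finset.mem_bipartiteAbove, mHi, SimpleGraph.mem_neighborFinset]
    constructor
    · exact fun h => h.2
    · intro h
      refine ⟨?_, h⟩
      by_contra hcon
      exact hG.low_indep h hu.2 (by omega)
  have e2 : ∀ v ∈ Hi, 25 + (Finset.bipartiteBelow G.Adj Lo v).card ≤ 4 * G.degree v := by
    intro v hv
    rw [mHi] at hv
    refine le_trans ?_ (hG.low_nbrs hv)
    gcongr
    intro w
    simp only [Finset.mem_bipartiteBelow, mLo, SimpleGraph.mem_neighborFinset, Finset.mem_filter]
    exact fun h => ⟨h.2.symm, h.1.2⟩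
  have e3 : ∀ v ∈ Lo, 5 ≤ G.degree v := by
    intro v hv
    rw [mLo] at hv
    obtain ⟨w, hw⟩ := (G.degree_pos_iff_exists_adj v).1 hv.1
    exact hG.min_degree hw
  rw [Finset.sum_congr rfl e1] at hdc
  have s2 := Finset.sum_le_sum e2
  have s3 := Finset.sum_le_sum e3
  rw [Finset.sum_add_distrib, Finset.sum_const, ← hdc, ← Finset.mul_sum] at s2
  rw [Finset.sum_const] at s3
  simp only [smul_eq_mul] at s2 s3
  rw [hP, Finset.card_union_of_disjoint hdisj]
  omega

/-- If `G` is a finite simple graph with maximum average degree less than 25/4, then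
τ(G) ≤ 2ν(G). -/
theorem tuza_of_mad_lt_25_div_4 [Fintype V] [DecidableEq V] (G : SimpleGraph V)
    (hmad : ∀ H : G.Subgraph, H.verts.Nonempty →
      (2 * H.edgeSet.ncard : ℚ) / (H.verts.ncard : ℚ) < 25 / 4) :
    triTau G ≤ 2 * triNu G := by
  classical
  apply GoodG.le
  by_contra hbad
  obtain ⟨G', ⟨hle, hnot⟩, hmin⟩ := WellFounded.has_min
    (wellFounded_lt (α := SimpleGraph V)) {H | H ≤ G ∧ ¬ GoodG H} ⟨G, le_rfl, hbad⟩
  have hG : CritG G' := by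
    refine ⟨hnot, fun H hH => ?_⟩
    by_contra hH'
    exact hmin H ⟨hH.le.trans hle, hH'⟩ hH
  have hdis := hG.discharge
  obtain ⟨P, hP⟩ : ∃ P, P = Finset.univ.filter (fun v => 0 < G'.degree v) := ⟨_, rfl⟩
  have mP : ∀ v, v ∈ P ↔ 0 < G'.degree v := by intro v; simp [hP]
  rw [← hP, SimpleGraph.sum_degrees_eq_twice_card_edges] at hdis
  let H : G.Subgraph :=
    { verts := ↑P
      Adj := G'.Adj
      adj_sub := fun h => hle h
      edge_vert := fun {a b} h => by
        rw [Finset.mem_coe, mP, SimpleGraph.degree_pos_iff_exists_adj]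
        exact ⟨b, h⟩
      symm := G'.symm }
  have hE : H.edgeSet = ↑G'.edgeFinset := by
    rw [SimpleGraph.coe_edgeFinset]
    ext e
    induction e with
    | _ a b => exact Iff.rfl
  have hne : P.Nonempty := by
    by_contra hemp
    rw [Finset.not_nonempty_iff_eq_empty] at hemp
    refine hnot ⟨∅, ∅, ⟨by simp, by simp⟩, ?_, by simp⟩
    intro a b c hab
    exfalso
    have : a ∈ P := by
      rw [mP, SimpleGraph.degree_pos_iff_exists_adj]
      exact ⟨b, hab⟩
    rw [hemp] at this
    simp at this
  have hm := hmad H hne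
  have hpos : (0 : ℚ) < P.card := by exact_mod_cast hne.card_pos
  have hV : H.verts.ncard = P.card := Set.ncard_coe_finset P
  rw [hE, Set.ncard_coe_finset, hV, div_lt_iff₀ hpos] at hm
  have hdis' : (25 : ℚ) * P.card ≤ 4 * (2 * G'.edgeFinset.card) := by exact_mod_cast hdis
  linarith
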